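/- arXiv:1007.2214 — 3 statements merged into one kernel-verified Lean document; each statement's English description precedes it below -/
import Mathlib

section
/- The Fourier projection F_n is the unique bounded linear projection of C(2π) onto π_n which commutes with all translations, i.e. the unique bounded linear projection P : C(2π) → π_n satisfying P ∘ T_g = T_g ∘ P for all g ∈ ℝ, where (T_g f)(t) = f(t + g). -/
open Real MeasureTheory intervalIntegral

noncomputable section

instance : Fact ((0:ℝ) < 2 * π) := ⟨by positivity⟩

/-- The circle `ℝ / 2πℤ`; continuous functions on it are exactly the continuous
`2π`-periodic real-valued functions on `ℝ`, and `C(Circ2π, ℝ)` carries the supremum norm. -/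
abbrev Circ2pi : Type := AddCircle (2 * π)

theorem cos_periodic' (k : ℕ) : Function.Periodic (fun t : ℝ => cos (k * t)) (2 * π) := by
  intro t
  show cos (k * (t + 2 * π)) = cos (k * t)
  have h : (k : ℝ) * (t + 2 * π) = k * t + (k : ℤ) * (2 * π) := by push_cast; ring
  rw [h, Real.cos_add_int_mul_two_pi]

theorem sin_periodic' (k : ℕ) : Function.Periodic (fun t : ℝ => sin (k * t)) (2 * π) := by
  intro t
  show sin (k * (t + 2 * π)) = sin (k * t)
  have h : (k : ℝ) * (t + 2 * π) = k * t + (k : ℤ) * (2 * π) := by push_cast; ring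
  rw [h, Real.sin_add_int_mul_two_pi]

/-- `t ↦ cos (k t)` as an element of `C(2π)`. -/
def cosP (k : ℕ) : C(Circ2pi, ℝ) :=
  ⟨(cos_periodic' k).lift,
   continuous_coinduced_dom.mpr (by fun_prop : Continuous fun t : ℝ => cos (k * t))⟩

/-- `t ↦ sin (k t)` as an element of `C(2π)`. -/
def sinP (k : ℕ) : C(Circ2pi, ℝ) :=
  ⟨(sin_periodic' k).lift,
   continuous_coinduced_dom.mpr (by fun_prop : Continuous fun t : ℝ => sin (k * t))⟩

theorem cosP_apply (k : ℕ) (t : ℝ) : cosP k (t : Circ2pi) = cos (k * t) :=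
  (cos_periodic' k).lift_coe t

theorem sinP_apply (k : ℕ) (t : ℝ) : sinP k (t : Circ2pi) = sin (k * t) :=
  (sin_periodic' k).lift_coe t

/-- `π_n`: the subspace of trigonometric polynomials of degree at most `n`, spanned by
`1 = cos (0 ⬝ t)`, `cos (k t)` and `sin (k t)` for `1 ≤ k ≤ n`. -/
def trigPoly (n : ℕ) : Submodule ℝ C(Circ2pi, ℝ) :=
  Submodule.span ℝ
    ((Set.range fun k : Fin (n + 1) => cosP k) ∪ (Set.range fun k : Fin n => sinP (k + 1)))

/-- Translation `(T_g f)(t) = f (t + g)` on `C(2π)`. -/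
def translateC (g : ℝ) (f : C(Circ2pi, ℝ)) : C(Circ2pi, ℝ) :=
  f.comp ⟨fun θ => θ + (g : Circ2pi), by continuity⟩

/-- `F` is the `n`-th Fourier projection `F_n`: for every `f ∈ C(2π)` and `t ∈ ℝ`,
`(F f)(t) = a₀/2 + ∑_{k=1}^n (a_k cos (k t) + b_k sin (k t))`, where
`a_k = (1/π) ∫_0^{2π} f(s) cos (k s) ds` and `b_k = (1/π) ∫_0^{2π} f(s) sin (k s) ds`. -/
def IsFourierProjection (n : ℕ) (F : C(Circ2pi, ℝ) →L[ℝ] C(Circ2pi, ℝ)) : Prop :=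
  ∀ (f : C(Circ2pi, ℝ)) (t : ℝ),
    F f (t : Circ2pi) =
      1 / (2 * π) * (∫ s in (0:ℝ)..(2 * π), f (s : Circ2pi)) +
      ∑ k ∈ Finset.Icc 1 n,
        ((1 / π * ∫ s in (0:ℝ)..(2 * π), f (s : Circ2pi) * cos (k * s)) * cos (k * t) +
         (1 / π * ∫ s in (0:ℝ)..(2 * π), f (s : Circ2pi) * sin (k * s)) * sin (k * t))

theorem integral_cos_int_mul {j : ℤ} (hj : j ≠ 0) :
    ∫ s in (0:ℝ)..(2 * π), cos (j * s) = 0 := by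
  have hj' : (j : ℝ) ≠ 0 := by exact_mod_cast hj
  rw [intervalIntegral.integral_comp_mul_left (fun x => cos x) hj', integral_cos]
  have h : sin ((j : ℝ) * (2 * π)) = 0 := by
    have := Real.sin_add_int_mul_two_pi 0 j
    simpa using this
  simp [h]

theorem integral_sin_int_mul (j : ℤ) : ∫ s in (0:ℝ)..(2 * π), sin (j * s) = 0 := by
  rcases eq_or_ne j 0 with rfl | hj
  · simp
  have hj' : (j : ℝ) ≠ 0 := by exact_mod_cast hj
  rw [intervalIntegral.integral_comp_mul_left (fun x => sin x) hj', integral_sin]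
  have h : cos ((j : ℝ) * (2 * π)) = 1 := by
    simp
  simp [h]

theorem integral_cos_mul_cos_of_ne {m k : ℕ} (h : m ≠ k) :
    ∫ s in (0:ℝ)..(2 * π), cos (m * s) * cos (k * s) = 0 := by
  have e : ∀ s : ℝ, cos (m * s) * cos (k * s) =
      (1 / 2) * (cos (((m - k : ℤ) : ℝ) * s) + cos (((m + k : ℤ) : ℝ) * s)) := by
    intro s
    push_cast
    rw [sub_mul, add_mul, cos_sub, cos_add]
    ring
  simp_rw [e]
  rw [intervalIntegral.integral_const_mul, intervalIntegral.integral_add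
    (Continuous.intervalIntegrable (by fun_prop) _ _)
    (Continuous.intervalIntegrable (by fun_prop) _ _),
    integral_cos_int_mul (by omega), integral_cos_int_mul (by omega)]
  simp

theorem integral_sin_mul_sin_of_ne {m k : ℕ} (h : m ≠ k) :
    ∫ s in (0:ℝ)..(2 * π), sin (m * s) * sin (k * s) = 0 := by
  have e : ∀ s : ℝ, sin (m * s) * sin (k * s) =
      (1 / 2) * (cos (((m - k : ℤ) : ℝ) * s) - cos (((m + k : ℤ) : ℝ) * s)) := by
    intro s
    push_cast
    rw [sub_mul, add_mul, cos_sub, cos_add]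
    ring
  simp_rw [e]
  rw [intervalIntegral.integral_const_mul, intervalIntegral.integral_sub
    (Continuous.intervalIntegrable (by fun_prop) _ _)
    (Continuous.intervalIntegrable (by fun_prop) _ _),
    integral_cos_int_mul (by omega), integral_cos_int_mul (by omega)]
  simp

theorem integral_sin_mul_cos_nat (m k : ℕ) :
    ∫ s in (0:ℝ)..(2 * π), sin (m * s) * cos (k * s) = 0 := by
  have e : ∀ s : ℝ, sin (m * s) * cos (k * s) =
      (1 / 2) * (sin (((m - k : ℤ) : ℝ) * s) + sin (((m + k : ℤ) : ℝ) * s)) := by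
    intro s
    push_cast
    rw [sub_mul, add_mul, sin_sub, sin_add]
    ring
  simp_rw [e]
  rw [intervalIntegral.integral_const_mul, intervalIntegral.integral_add
    (Continuous.intervalIntegrable (by fun_prop) _ _)
    (Continuous.intervalIntegrable (by fun_prop) _ _),
    integral_sin_int_mul, integral_sin_int_mul]
  simp

theorem integral_cos_mul_self {m : ℕ} (hm : m ≠ 0) :
    ∫ s in (0:ℝ)..(2 * π), cos (m * s) * cos (m * s) = π := by
  have e : ∀ s : ℝ, cos (m * s) * cos (m * s) =
      (1 / 2) * (1 + cos (((2 * m : ℤ) : ℝ) * s)) := by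
    intro s
    push_cast
    rw [mul_assoc, cos_two_mul]
    ring
  simp_rw [e]
  rw [intervalIntegral.integral_const_mul, intervalIntegral.integral_add
    (Continuous.intervalIntegrable (by fun_prop) _ _)
    (Continuous.intervalIntegrable (by fun_prop) _ _), integral_cos_int_mul (by omega)]
  simp

theorem integral_sin_mul_self {m : ℕ} (hm : m ≠ 0) :
    ∫ s in (0:ℝ)..(2 * π), sin (m * s) * sin (m * s) = π := by
  have e : ∀ s : ℝ, sin (m * s) * sin (m * s) =
      (1 / 2) * (1 - cos (((2 * m : ℤ) : ℝ) * s)) := by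
    intro s
    push_cast
    rw [mul_assoc, cos_two_mul, cos_sq']
    ring
  simp_rw [e]
  rw [intervalIntegral.integral_const_mul, intervalIntegral.integral_sub
    (Continuous.intervalIntegrable (by fun_prop) _ _)
    (Continuous.intervalIntegrable (by fun_prop) _ _), integral_cos_int_mul (by omega)]
  simp

theorem Circ2pi.ext_coe {f g : C(Circ2pi, ℝ)} (h : ∀ t : ℝ, f (t : Circ2pi) = g (t : Circ2pi)) :
    f = g := by
  ext x
  obtain ⟨t, rfl⟩ := QuotientAddGroup.mk_surjective x
  exact h t

theorem sinP_zero : sinP 0 = 0 :=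
  Circ2pi.ext_coe fun t => by simp [sinP_apply]

theorem cosP_mem_trigPoly {k n : ℕ} (h : k ≤ n) : cosP k ∈ trigPoly n :=
  Submodule.subset_span (Or.inl ⟨⟨k, by omega⟩, rfl⟩)

theorem sinP_mem_trigPoly {k n : ℕ} (h : k ≤ n) : sinP k ∈ trigPoly n := by
  rcases k with _ | k
  · rw [sinP_zero]
    exact zero_mem _
  · exact Submodule.subset_span (Or.inr ⟨⟨k, by omega⟩, rfl⟩)

theorem translateC_cosP (g : ℝ) (k : ℕ) :
    translateC g (cosP k) = cos (k * g) • cosP k - sin (k * g) • sinP k := by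
  refine Circ2pi.ext_coe fun t => ?_
  change cosP k ((t + g : ℝ) : Circ2pi) = cos (k * g) * cosP k t - sin (k * g) * sinP k t
  rw [cosP_apply, cosP_apply, sinP_apply, mul_add, cos_add]
  ring

theorem translateC_sinP (g : ℝ) (k : ℕ) :
    translateC g (sinP k) = sin (k * g) • cosP k + cos (k * g) • sinP k := by
  refine Circ2pi.ext_coe fun t => ?_
  change sinP k ((t + g : ℝ) : Circ2pi) = sin (k * g) * cosP k t + cos (k * g) * sinP k t
  rw [sinP_apply, cosP_apply, sinP_apply, mul_add, sin_add]
  ring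

/-- Translation as a continuous linear map. -/
def translateCLM (g : ℝ) : C(Circ2pi, ℝ) →L[ℝ] C(Circ2pi, ℝ) where
  toFun := translateC g
  map_add' _ _ := rfl
  map_smul' _ _ := rfl
  cont := ContinuousMap.continuous_precomp _

/-- The space of all real trigonometric polynomials. -/
def trigPolyAll : Submodule ℝ C(Circ2pi, ℝ) :=
  Submodule.span ℝ (Set.range cosP ∪ Set.range sinP)

theorem re_im_mem_trigPolyAll {f : C(Circ2pi, ℂ)}
    (hf : f ∈ Submodule.span ℂ (Set.range (@fourier (2 * π)))) :
    (⟨Complex.re, Complex.continuous_re⟩ : C(ℂ, ℝ)).comp f ∈ trigPolyAll ∧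
    (⟨Complex.im, Complex.continuous_im⟩ : C(ℂ, ℝ)).comp f ∈ trigPolyAll := by
  induction hf using Submodule.span_induction with
  | mem f hf =>
    obtain ⟨m, rfl⟩ := hf
    have key : ∀ t : ℝ, fourier m (t : Circ2pi) = Complex.exp ((m * t : ℝ) * Complex.I) := by
      intro t
      rw [fourier_coe_apply]
      congr 1
      push_cast
      field_simp
    have hc (k : ℕ) : cosP k ∈ trigPolyAll := Submodule.subset_span (Or.inl ⟨k, rfl⟩)
    have hs (k : ℕ) : sinP k ∈ trigPolyAll := Submodule.subset_span (Or.inr ⟨k, rfl⟩)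
    obtain ⟨k, rfl | rfl⟩ := m.eq_nat_or_neg
    · constructor
      · convert hc k
        refine Circ2pi.ext_coe fun t => ?_
        rw [ContinuousMap.comp_apply, key, cosP_apply, ContinuousMap.coe_mk,
          Complex.exp_ofReal_mul_I_re]
        simp
      · convert hs k
        refine Circ2pi.ext_coe fun t => ?_
        rw [ContinuousMap.comp_apply, key, sinP_apply, ContinuousMap.coe_mk,
          Complex.exp_ofReal_mul_I_im]
        simp
    · constructor
      · convert hc k
        refine Circ2pi.ext_coe fun t => ?_
        rw [ContinuousMap.comp_apply, key, cosP_apply, ContinuousMap.coe_mk,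
          Complex.exp_ofReal_mul_I_re]
        simp
      · convert neg_mem (hs k)
        refine Circ2pi.ext_coe fun t => ?_
        rw [ContinuousMap.comp_apply, key, ContinuousMap.neg_apply, sinP_apply,
          ContinuousMap.coe_mk, Complex.exp_ofReal_mul_I_im]
        simp
  | zero => exact ⟨zero_mem _, zero_mem _⟩
  | add f g _ _ hf hg => exact ⟨add_mem hf.1 hg.1, add_mem hf.2 hg.2⟩
  | smul c f _ hf =>
    constructor
    · convert sub_mem (Submodule.smul_mem _ c.re hf.1) (Submodule.smul_mem _ c.im hf.2)
      ext x
      simp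
    · convert add_mem (Submodule.smul_mem _ c.re hf.2) (Submodule.smul_mem _ c.im hf.1)
      ext x
      simp

theorem dense_trigPolyAll : Dense (trigPolyAll : Set C(Circ2pi, ℝ)) := by
  intro f
  let F : C(Circ2pi, ℂ) := (⟨Complex.ofReal, Complex.continuous_ofReal⟩ : C(ℝ, ℂ)).comp f
  have hF : F ∈ closure (Submodule.span ℂ (Set.range (@fourier (2 * π))) :
      Set C(Circ2pi, ℂ)) := by
    rw [← Submodule.topologicalClosure_coe, span_fourier_closure_eq_top]
    trivial
  exact map_mem_closure
    (ContinuousMap.continuous_postcomp (⟨Complex.re, Complex.continuous_re⟩ : C(ℂ, ℝ)))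
    hF fun g hg => (re_im_mem_trigPolyAll hg).1

theorem clm_ext_cosP_sinP {P Q : C(Circ2pi, ℝ) →L[ℝ] C(Circ2pi, ℝ)}
    (hc : ∀ k, P (cosP k) = Q (cosP k)) (hs : ∀ k, P (sinP k) = Q (sinP k)) : P = Q := by
  refine ContinuousLinearMap.ext_on dense_trigPolyAll ?_
  rintro _ (⟨k, rfl⟩ | ⟨k, rfl⟩)
  exacts [hc k, hs k]

namespace IsFourierProjection

variable {n : ℕ} {F : C(Circ2pi, ℝ) →L[ℝ] C(Circ2pi, ℝ)}

theorem map_cosP (hF : IsFourierProjection n F) (m : ℕ) :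
    F (cosP m) = if m ≤ n then cosP m else 0 := by
  refine Circ2pi.ext_coe fun t => ?_
  rw [hF]
  simp only [cosP_apply, mul_comm (cos _) (sin _), integral_sin_mul_cos_nat]
  rcases eq_or_ne m 0 with rfl | hm
  · rw [Finset.sum_eq_zero]
    · simp [cosP_apply]
      field_simp
    · intro k hk
      rw [integral_cos_mul_cos_of_ne (by have := Finset.mem_Icc.1 hk; omega)]
      simp
  · have h0 : ∫ s in (0:ℝ)..(2 * π), cos (m * s) = 0 := by
      exact_mod_cast integral_cos_int_mul (j := m) (by omega)
    rw [h0]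
    split_ifs with h
    · rw [Finset.sum_eq_single_of_mem m (Finset.mem_Icc.2 ⟨by omega, h⟩),
        integral_cos_mul_self hm, cosP_apply]
      · field_simp
        simp
        ring
      · intro k _ hk
        rw [integral_cos_mul_cos_of_ne hk.symm]
        simp
    · rw [Finset.sum_eq_zero]
      · simp
      · intro k hk
        rw [integral_cos_mul_cos_of_ne (by have := Finset.mem_Icc.1 hk; omega)]
        simp

theorem map_sinP (hF : IsFourierProjection n F) (m : ℕ) :
    F (sinP m) = if m ≤ n then sinP m else 0 := by
  rcases eq_or_ne m 0 with rfl | hm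
  · simp [sinP_zero]
  refine Circ2pi.ext_coe fun t => ?_
  rw [hF]
  have h0 : ∫ s in (0:ℝ)..(2 * π), sin (m * s) = 0 := by
    exact_mod_cast integral_sin_int_mul m
  simp only [sinP_apply, integral_sin_mul_cos_nat, h0]
  split_ifs with h
  · rw [Finset.sum_eq_single_of_mem m (Finset.mem_Icc.2 ⟨by omega, h⟩),
      integral_sin_mul_self hm, sinP_apply]
    · field_simp
      simp
      ring
    · intro k _ hk
      rw [integral_sin_mul_sin_of_ne hk.symm]
      simp
  · rw [Finset.sum_eq_zero]
    · simp
    · intro k hk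
      rw [integral_sin_mul_sin_of_ne (by have := Finset.mem_Icc.1 hk; omega)]
      simp

theorem map_mem_trigPoly (hF : IsFourierProjection n F) (f : C(Circ2pi, ℝ)) :
    F f ∈ trigPoly n := by
  have h : F f = (1 / (2 * π) * ∫ s in (0:ℝ)..(2 * π), f (s : Circ2pi)) • cosP 0 +
      ∑ k ∈ Finset.Icc 1 n,
        ((1 / π * ∫ s in (0:ℝ)..(2 * π), f (s : Circ2pi) * cos (k * s)) • cosP k +
         (1 / π * ∫ s in (0:ℝ)..(2 * π), f (s : Circ2pi) * sin (k * s)) • sinP k) := by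
    refine Circ2pi.ext_coe fun t => ?_
    rw [hF]
    simp [ContinuousMap.sum_apply, cosP_apply, sinP_apply]
  rw [h]
  refine add_mem (Submodule.smul_mem _ _ (cosP_mem_trigPoly n.zero_le))
    (sum_mem fun k hk => ?_)
  have hk := (Finset.mem_Icc.1 hk).2
  exact add_mem (Submodule.smul_mem _ _ (cosP_mem_trigPoly hk))
    (Submodule.smul_mem _ _ (sinP_mem_trigPoly hk))

theorem map_eq_self (hF : IsFourierProjection n F) {v : C(Circ2pi, ℝ)} (hv : v ∈ trigPoly n) :
    F v = v := by
  induction hv using Submodule.span_induction with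
  | mem v hv =>
    rcases hv with ⟨k, rfl⟩ | ⟨k, rfl⟩
    · exact (hF.map_cosP k).trans (if_pos (by omega))
    · exact (hF.map_sinP (k + 1)).trans (if_pos (by omega))
  | zero => exact map_zero F
  | add v w _ _ hv hw => rw [map_add, hv, hw]
  | smul c v _ hv => rw [map_smul, hv]

theorem map_translateC (hF : IsFourierProjection n F) (g : ℝ) (f : C(Circ2pi, ℝ)) :
    F (translateC g f) = translateC g (F f) := by
  have h : F ∘L translateCLM g = translateCLM g ∘L F := by
    refine clm_ext_cosP_sinP (fun k => ?_) fun k => ?_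
    · change F (translateC g (cosP k)) = translateCLM g (F (cosP k))
      rw [translateC_cosP, map_sub, map_smul, map_smul, hF.map_cosP, hF.map_sinP]
      split_ifs
      · exact (translateC_cosP g k).symm
      · simp
    · change F (translateC g (sinP k)) = translateCLM g (F (sinP k))
      rw [translateC_sinP, map_add, map_smul, map_smul, hF.map_cosP, hF.map_sinP]
      split_ifs
      · exact (translateC_sinP g k).symm
      · simp
  exact DFunLike.congr_fun h f

end IsFourierProjection

theorem map_cosP_of_commute {P : C(Circ2pi, ℝ) →L[ℝ] C(Circ2pi, ℝ)}
    (hP : ∀ (g : ℝ) (f : C(Circ2pi, ℝ)), P (translateC g f) = translateC g (P f)) (k : ℕ) :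
    P (cosP k) = P (cosP k) (0 : ℝ) • cosP k - P (sinP k) (0 : ℝ) • sinP k := by
  refine Circ2pi.ext_coe fun g => ?_
  have h := congrArg (fun f => f ((0 : ℝ) : Circ2pi)) (hP g (cosP k))
  rw [translateC_cosP, map_sub, map_smul, map_smul] at h
  change cos (k * g) * P (cosP k) (0 : ℝ) - sin (k * g) * P (sinP k) (0 : ℝ) =
    P (cosP k) ((0 + g : ℝ) : Circ2pi) at h
  rw [zero_add] at h
  rw [← h, ContinuousMap.sub_apply, ContinuousMap.smul_apply, ContinuousMap.smul_apply,
    cosP_apply, sinP_apply, smul_eq_mul, smul_eq_mul]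
  ring

theorem map_sinP_of_commute {P : C(Circ2pi, ℝ) →L[ℝ] C(Circ2pi, ℝ)}
    (hP : ∀ (g : ℝ) (f : C(Circ2pi, ℝ)), P (translateC g f) = translateC g (P f)) (k : ℕ) :
    P (sinP k) = P (sinP k) (0 : ℝ) • cosP k + P (cosP k) (0 : ℝ) • sinP k := by
  refine Circ2pi.ext_coe fun g => ?_
  have h := congrArg (fun f => f ((0 : ℝ) : Circ2pi)) (hP g (sinP k))
  rw [translateC_sinP, map_add, map_smul, map_smul] at h
  change sin (k * g) * P (cosP k) (0 : ℝ) + cos (k * g) * P (sinP k) (0 : ℝ) =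
    P (sinP k) ((0 + g : ℝ) : Circ2pi) at h
  rw [zero_add] at h
  rw [← h, ContinuousMap.add_apply, ContinuousMap.smul_apply, ContinuousMap.smul_apply,
    cosP_apply, sinP_apply, smul_eq_mul, smul_eq_mul]
  ring

/-- The Fourier projection `F_n` is the unique bounded linear projection of `C(2π)` onto
`π_n` which commutes with all translations `T_g`, `(T_g f)(t) = f (t + g)`. -/
theorem fourierProjection_unique_commuting (n : ℕ) (hn : 1 ≤ n)
    (F : C(Circ2pi, ℝ) →L[ℝ] C(Circ2pi, ℝ)) (hF : IsFourierProjection n F) :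
    (∀ f : C(Circ2pi, ℝ), F f ∈ trigPoly n) ∧ (∀ v ∈ trigPoly n, F v = v) ∧
    (∀ (g : ℝ) (f : C(Circ2pi, ℝ)), F (translateC g f) = translateC g (F f)) ∧
    (∀ P : C(Circ2pi, ℝ) →L[ℝ] C(Circ2pi, ℝ),
      (∀ f : C(Circ2pi, ℝ), P f ∈ trigPoly n) → (∀ v ∈ trigPoly n, P v = v) →
      (∀ (g : ℝ) (f : C(Circ2pi, ℝ)), P (translateC g f) = translateC g (P f)) → P = F) := by
  refine ⟨hF.map_mem_trigPoly, fun _ => hF.map_eq_self, hF.map_translateC,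
    fun P hmem hid hP => clm_ext_cosP_sinP (fun k => ?_) fun k => ?_⟩
  · rw [hF.map_cosP]
    split_ifs with h
    · exact hid _ (cosP_mem_trigPoly h)
    · rw [← hF.map_eq_self (hmem (cosP k)), map_cosP_of_commute hP, map_sub, map_smul, map_smul,
        hF.map_cosP, hF.map_sinP, if_neg h, if_neg h]
      simp
  · rw [hF.map_sinP]
    split_ifs with h
    · exact hid _ (sinP_mem_trigPoly h)
    · rw [← hF.map_eq_self (hmem (sinP k)), map_sinP_of_commute hP, map_add, map_smul, map_smul,
        hF.map_cosP, hF.map_sinP, if_neg h, if_neg h]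
      simp
end
end

section
/- For every n ≥ 1 the operator norm of the Fourier projection F_n on C(2π) satisfies (4/π²) ln(n) ≤ ‖F_n‖ ≤ ln(n) + 3, and the same bounds hold for its numerical radius: (4/π²) ln(n) ≤ ‖F_n‖_w ≤ ln(n) + 3. -/
open Real MeasureTheory intervalIntegral

noncomputable section

/-- The numerical radius of a bounded linear operator `L` on `X`:
`‖L‖_w = sup { |x*(L x)| : ‖x‖ = ‖x*‖ = 1, x*(x) = 1 }`. -/
def numericalRadius {𝕜 : Type*} [RCLike 𝕜] {X : Type*} [NormedAddCommGroup X]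
    [NormedSpace 𝕜 X] (L : X →L[𝕜] X) : ℝ :=
  sSup {r : ℝ | ∃ (x : X) (f : X →L[𝕜] 𝕜), ‖x‖ = 1 ∧ ‖f‖ = 1 ∧ f x = 1 ∧ r = ‖f (L x)‖}

/-- The Dirichlet kernel `1/2 + ∑_{k=1}^n cos (k x)`. -/
def dirichletKer (n : ℕ) (x : ℝ) : ℝ := 1 / 2 + ∑ k ∈ Finset.Icc 1 n, cos (k * x)

/-- The Dirichlet kernel as an element of `C(2π)`. -/
def dirichletKerC (n : ℕ) : C(Circ2pi, ℝ) :=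
  ContinuousMap.const _ (1 / 2) + ∑ k ∈ Finset.Icc 1 n, cosP k

theorem dirichletKerC_apply (n : ℕ) (t : ℝ) :
    dirichletKerC n (t : Circ2pi) = dirichletKer n t := by
  simp [dirichletKerC, dirichletKer, ContinuousMap.sum_apply, cosP_apply]

theorem continuous_dirichletKer (n : ℕ) : Continuous (dirichletKer n) := by
  unfold dirichletKer
  fun_prop

theorem dirichletKer_periodic (n : ℕ) : Function.Periodic (dirichletKer n) (2 * π) := by
  intro t
  simp only [dirichletKer]
  congr 1
  exact Finset.sum_congr rfl fun k _ => cos_periodic' k t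

theorem dirichletKer_neg (n : ℕ) (x : ℝ) : dirichletKer n (-x) = dirichletKer n x := by
  simp [dirichletKer]

theorem dirichletKer_zero (n : ℕ) : dirichletKer n 0 = 1 / 2 + n := by
  simp [dirichletKer]

theorem abs_dirichletKer_le (n : ℕ) (x : ℝ) : |dirichletKer n x| ≤ 1 / 2 + n := by
  refine (abs_add_le _ _).trans ?_
  rw [abs_of_pos (by norm_num : (0 : ℝ) < 1 / 2)]
  gcongr
  refine (Finset.abs_sum_le_sum_abs _ _).trans ?_
  refine (Finset.sum_le_card_nsmul _ _ 1 fun k _ => abs_cos_le_one _).trans ?_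
  simp

theorem two_sin_mul_dirichletKer (n : ℕ) (x : ℝ) :
    2 * sin (x / 2) * dirichletKer n x = sin ((n + 1 / 2) * x) := by
  induction n with
  | zero => simp [dirichletKer]; ring_nf
  | succ n ih =>
    have h : dirichletKer (n + 1) x = dirichletKer n x + cos ((n + 1 : ℕ) * x) := by
      simp only [dirichletKer]
      rw [Finset.sum_Icc_succ_top (by omega)]
      ring
    have e1 : (n + 1 / 2 : ℝ) * x = (n + 1) * x - x / 2 := by ring
    have e2 : ((n + 1 : ℕ) + 1 / 2 : ℝ) * x = (n + 1) * x + x / 2 := by push_cast; ring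
    rw [h, mul_add, ih, e1, e2, sin_sub, sin_add]
    push_cast
    ring

theorem abs_sin_le_mul_abs_dirichletKer (n : ℕ) {x : ℝ} (hx : 0 ≤ x) :
    |sin ((n + 1 / 2) * x)| ≤ x * |dirichletKer n x| := by
  rw [← two_sin_mul_dirichletKer, abs_mul, abs_mul, abs_two]
  gcongr
  have := (abs_sin_le_abs (x := x / 2))
  rw [abs_of_nonneg (by positivity : (0 : ℝ) ≤ x / 2)] at this
  linarith

theorem abs_dirichletKer_le_inv (n : ℕ) {x : ℝ} (hx : 0 < x) (hx' : x ≤ π) :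
    |dirichletKer n x| ≤ π / 2 * x⁻¹ := by
  have h1 : 2 / π * (x / 2) ≤ sin (x / 2) := mul_le_sin (by positivity) (by linarith)
  have h2 : 2 * sin (x / 2) * |dirichletKer n x| ≤ 1 := by
    have h3 := congrArg abs (two_sin_mul_dirichletKer n x)
    have h4 : 0 ≤ 2 / π * (x / 2) := by positivity
    rw [abs_mul, abs_of_nonneg (by linarith : (0 : ℝ) ≤ 2 * sin (x / 2))] at h3
    exact h3 ▸ abs_sin_le_one _
  have h5 : 2 / π * x * |dirichletKer n x| ≤ 1 :=
    le_trans (mul_le_mul_of_nonneg_right (by linarith) (abs_nonneg _)) h2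
  have h6 : 2 / π * x * |dirichletKer n x| = |dirichletKer n x| / (π / 2 * x⁻¹) := by
    field_simp
  rwa [h6, div_le_one (by positivity)] at h5

theorem integral_abs_dirichletKer (n : ℕ) :
    ∫ x in (0 : ℝ)..(2 * π), |dirichletKer n x| = 2 * ∫ x in (0 : ℝ)..π, |dirichletKer n x| := by
  have hc : Continuous fun x => |dirichletKer n x| := (continuous_dirichletKer n).abs
  have h : ∫ x in (0 : ℝ)..π, |dirichletKer n (2 * π - x)| =
      ∫ x in π..(2 * π), |dirichletKer n x| := by
    rw [intervalIntegral.integral_comp_sub_left (fun x => |dirichletKer n x|)]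
    congr 1 <;> ring
  have h' : ∀ x, dirichletKer n (2 * π - x) = dirichletKer n x := fun x => by
    rw [sub_eq_neg_add, dirichletKer_periodic n, dirichletKer_neg]
  simp only [h'] at h
  rw [← integral_add_adjacent_intervals (hc.intervalIntegrable 0 π)
    (hc.intervalIntegrable π (2 * π)), ← h]
  ring

theorem integral_abs_sin_period (k : ℕ) :
    ∫ x in (k * π)..((k + 1) * π), |sin x| = 2 := by
  have hp : Function.Periodic (fun x => |sin x|) π := fun x => by simp [sin_add_pi]
  have h := hp.intervalIntegral_add_eq (k * π) 0
  rw [show (k + 1 : ℝ) * π = k * π + π by ring, h, zero_add]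
  rw [integral_congr (g := sin), integral_sin]
  · norm_num
  · intro x hx
    rw [Set.uIcc_of_le pi_pos.le] at hx
    exact abs_of_nonneg (sin_nonneg_of_mem_Icc hx)

theorem two_div_pi_mul_log_le_integral_abs_dirichletKer (n : ℕ) (hn : 1 ≤ n) :
    2 / π * Real.log n ≤ ∫ x in (0 : ℝ)..π, |dirichletKer n x| := by
  have hc : Continuous fun x => |dirichletKer n x| := (continuous_dirichletKer n).abs
  set N : ℝ := n + 1 / 2 with hN
  have hN0 : 0 < N := by positivity
  have hstep : ∀ k ∈ Finset.range n, 2 / π * ((k : ℝ) + 1)⁻¹ ≤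
      ∫ x in (k * π / N)..((k + 1 : ℕ) * π / N), |dirichletKer n x| := by
    intro k _
    have hle : (k : ℝ) * π / N ≤ (k + 1 : ℕ) * π / N := by
      gcongr
      simp
    have h1 : ∫ x in (k * π / N)..((k + 1 : ℕ) * π / N),
        N / ((k + 1) * π) * |sin (N * x)| = 2 / π * ((k : ℝ) + 1)⁻¹ := by
      rw [intervalIntegral.integral_const_mul,
        intervalIntegral.integral_comp_mul_left (fun x => |sin x|) hN0.ne',
        mul_div_cancel₀ _ hN0.ne', mul_div_cancel₀ _ hN0.ne']
      push_cast
      rw [integral_abs_sin_period, smul_eq_mul]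
      field_simp
    rw [← h1]
    refine integral_mono_on hle (Continuous.intervalIntegrable (by fun_prop) _ _)
      (hc.intervalIntegrable _ _) fun x hx => ?_
    have hx0 : 0 ≤ x := le_trans (by positivity) hx.1
    have h2 : |sin (N * x)| ≤ ((k + 1) * π / N) * |dirichletKer n x| := by
      refine (abs_sin_le_mul_abs_dirichletKer n hx0).trans ?_
      gcongr
      simpa using hx.2
    calc N / ((k + 1) * π) * |sin (N * x)|
        ≤ N / ((k + 1) * π) * (((k + 1) * π / N) * |dirichletKer n x|) := by gcongr
      _ = |dirichletKer n x| := by field_simp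
  have hsum := Finset.sum_le_sum hstep
  rw [sum_integral_adjacent_intervals (a := fun k : ℕ => (k : ℝ) * π / N)
    (fun k _ => hc.intervalIntegrable _ _), ← Finset.mul_sum] at hsum
  have hharm : Real.log n ≤ ∑ k ∈ Finset.range n, ((k : ℝ) + 1)⁻¹ := by
    have h := log_add_one_le_harmonic n
    simp only [harmonic] at h
    push_cast at h
    refine le_trans (Real.log_le_log (by positivity) ?_) h
    linarith
  calc 2 / π * Real.log n ≤ 2 / π * ∑ k ∈ Finset.range n, ((k : ℝ) + 1)⁻¹ := by gcongr
    _ ≤ _ := hsum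
    _ ≤ _ := by
      refine integral_mono_interval (by simp) (by simp only [Nat.cast_zero, zero_mul, zero_div]; positivity) ?_
        (Filter.Eventually.of_forall fun x => abs_nonneg _) (hc.intervalIntegrable _ _)
      rw [div_le_iff₀ hN0, mul_comm]
      gcongr
      linarith

theorem integral_abs_dirichletKer_le (n : ℕ) (hn : 1 ≤ n) :
    ∫ x in (0 : ℝ)..π, |dirichletKer n x| ≤ π / 2 * (Real.log n + 3) := by
  have hc : Continuous fun x => |dirichletKer n x| := (continuous_dirichletKer n).abs
  have hn' : (1 : ℝ) ≤ n := by exact_mod_cast hn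
  have hn0 : (0 : ℝ) < n := by linarith
  have hinv : (n : ℝ)⁻¹ ≤ 1 := inv_le_one_of_one_le₀ hn'
  have hle : (n : ℝ)⁻¹ ≤ π := hinv.trans (by linarith [pi_gt_three])
  have h1 : ∫ x in (0 : ℝ)..(n : ℝ)⁻¹, |dirichletKer n x| ≤ 3 / 2 := by
    have h := integral_mono_on (μ := volume) (a := 0) (b := (n : ℝ)⁻¹) (by positivity)
      (hc.intervalIntegrable _ _) (intervalIntegrable_const (c := 1 / 2 + (n : ℝ)))
      fun x _ => abs_dirichletKer_le n x
    rw [intervalIntegral.integral_const, smul_eq_mul, sub_zero, mul_add,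
      inv_mul_cancel₀ hn0.ne'] at h
    linarith
  have h2 : ∫ x in (n : ℝ)⁻¹..π, |dirichletKer n x| ≤ π / 2 * (Real.log n + Real.log π) := by
    have hi : IntervalIntegrable (fun x : ℝ => π / 2 * x⁻¹) volume (n : ℝ)⁻¹ π := by
      refine (ContinuousOn.intervalIntegrable ?_)
      refine continuousOn_const.mul (continuousOn_inv₀.mono fun x hx => ?_)
      rw [Set.uIcc_of_le hle] at hx
      exact (lt_of_lt_of_le (by positivity) hx.1).ne'
    have h := integral_mono_on hle (hc.intervalIntegrable _ _) hi
      fun x hx => abs_dirichletKer_le_inv n (lt_of_lt_of_le (by positivity) hx.1) hx.2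
    rw [intervalIntegral.integral_const_mul, integral_inv_of_pos (by positivity) pi_pos,
      div_inv_eq_mul, Real.log_mul pi_pos.ne' hn0.ne'] at h
    linarith
  have hlog : Real.log π ≤ 2 := by
    have h := Real.log_le_log pi_pos pi_le_four
    rw [show (4 : ℝ) = 2 ^ 2 by norm_num, Real.log_pow] at h
    push_cast at h
    linarith [Real.log_two_lt_d9]
  rw [← integral_add_adjacent_intervals (hc.intervalIntegrable 0 (n : ℝ)⁻¹)
    (hc.intervalIntegrable _ _)]
  nlinarith [pi_gt_three]

theorem IsFourierProjection.apply_eq_integral {n : ℕ} {F : C(Circ2pi, ℝ) →L[ℝ] C(Circ2pi, ℝ)}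
    (hF : IsFourierProjection n F) (f : C(Circ2pi, ℝ)) (t : ℝ) :
    F f (t : Circ2pi) =
      1 / π * ∫ s in (0 : ℝ)..(2 * π), f (s : Circ2pi) * dirichletKer n (s - t) := by
  have hf : Continuous fun s : ℝ => f (s : Circ2pi) :=
    f.continuous.comp (AddCircle.continuous_mk' _)
  have hcos : ∀ (k : ℕ), IntervalIntegrable (fun s : ℝ => f (s : Circ2pi) * cos (k * s))
    volume 0 (2 * π) := fun k => Continuous.intervalIntegrable (by fun_prop) _ _
  have hsin : ∀ (k : ℕ), IntervalIntegrable (fun s : ℝ => f (s : Circ2pi) * sin (k * s))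
    volume 0 (2 * π) := fun k => Continuous.intervalIntegrable (by fun_prop) _ _
  have hexp : ∀ s : ℝ, f (s : Circ2pi) * dirichletKer n (s - t) =
      f (s : Circ2pi) * (1 / 2) + ∑ k ∈ Finset.Icc 1 n,
        (f (s : Circ2pi) * cos (k * s) * cos (k * t) +
          f (s : Circ2pi) * sin (k * s) * sin (k * t)) := by
    intro s
    rw [dirichletKer, mul_add, Finset.mul_sum]
    congr 1
    refine Finset.sum_congr rfl fun k _ => ?_
    rw [mul_sub, cos_sub]
    ring
  have hterm : ∀ k : ℕ, IntervalIntegrable (fun s : ℝ =>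
      f (s : Circ2pi) * cos (k * s) * cos (k * t) + f (s : Circ2pi) * sin (k * s) * sin (k * t))
      volume 0 (2 * π) :=
    fun k => ((hcos k).mul_const _).add ((hsin k).mul_const _)
  rw [hF, integral_congr fun s _ => hexp s,
    intervalIntegral.integral_add (Continuous.intervalIntegrable (by fun_prop) _ _)
      (Continuous.intervalIntegrable (by fun_prop) _ _),
    intervalIntegral.integral_finsetSum fun k _ => hterm k, mul_add, Finset.mul_sum,
    intervalIntegral.integral_mul_const]
  congr 1
  · field_simp
  · refine Finset.sum_congr rfl fun k _ => ?_
    rw [intervalIntegral.integral_add ((hcos k).mul_const _) ((hsin k).mul_const _),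
      intervalIntegral.integral_mul_const, intervalIntegral.integral_mul_const]
    ring

theorem IsFourierProjection.norm_le {n : ℕ} {F : C(Circ2pi, ℝ) →L[ℝ] C(Circ2pi, ℝ)}
    (hF : IsFourierProjection n F) :
    ‖F‖ ≤ 2 / π * ∫ x in (0 : ℝ)..π, |dirichletKer n x| := by
  have hD := continuous_dirichletKer n
  have hnn : 0 ≤ ∫ x in (0 : ℝ)..π, |dirichletKer n x| :=
    integral_nonneg pi_pos.le fun x _ => abs_nonneg _
  refine F.opNorm_le_bound (by positivity) fun f => ?_
  refine (ContinuousMap.norm_le _ (by positivity)).2 fun θ => ?_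
  obtain ⟨t, rfl⟩ := QuotientAddGroup.mk_surjective θ
  have hf : Continuous fun s : ℝ => f (s : Circ2pi) :=
    f.continuous.comp (AddCircle.continuous_mk' _)
  have hshift : ∫ s in (0 : ℝ)..(2 * π), |dirichletKer n (s - t)| =
      2 * ∫ x in (0 : ℝ)..π, |dirichletKer n x| := by
    have hp : Function.Periodic (fun x => |dirichletKer n x|) (2 * π) := fun x => by
      simp only [dirichletKer_periodic n x]
    have h := hp.intervalIntegral_add_eq (0 - t) 0
    rw [intervalIntegral.integral_comp_sub_right (fun x => |dirichletKer n x|),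
      ← integral_abs_dirichletKer, show 2 * π - t = 0 - t + 2 * π by ring, h, zero_add]
  have hmain : |∫ s in (0 : ℝ)..(2 * π), f (s : Circ2pi) * dirichletKer n (s - t)| ≤
      ‖f‖ * (2 * ∫ x in (0 : ℝ)..π, |dirichletKer n x|) := by
    refine (abs_integral_le_integral_abs two_pi_pos.le).trans ?_
    rw [← hshift, ← intervalIntegral.integral_const_mul]
    refine integral_mono_on two_pi_pos.le (Continuous.intervalIntegrable (by fun_prop) _ _)
      (Continuous.intervalIntegrable (by fun_prop) _ _) fun s _ => ?_
    rw [abs_mul]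
    exact mul_le_mul_of_nonneg_right (f.norm_coe_le_norm _) (abs_nonneg _)
  have happ := hF.apply_eq_integral f t
  calc ‖F f (t : Circ2pi)‖
      = 1 / π * |∫ s in (0 : ℝ)..(2 * π), f (s : Circ2pi) * dirichletKer n (s - t)| := by
        rw [happ, Real.norm_eq_abs, abs_mul, abs_of_pos (by positivity : 0 < 1 / π)]
    _ ≤ 1 / π * (‖f‖ * (2 * ∫ x in (0 : ℝ)..π, |dirichletKer n x|)) := by gcongr
    _ = 2 / π * (∫ x in (0 : ℝ)..π, |dirichletKer n x|) * ‖f‖ := by ring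

section NumericalRadius

variable {𝕜 : Type*} [RCLike 𝕜] {X : Type*} [NormedAddCommGroup X] [NormedSpace 𝕜 X]

theorem norm_apply_apply_le_opNorm (L : X →L[𝕜] X) {x : X} {f : X →L[𝕜] 𝕜} (hx : ‖x‖ = 1)
    (hf : ‖f‖ = 1) : ‖f (L x)‖ ≤ ‖L‖ := by
  have h1 := f.le_opNorm (L x)
  have h2 := L.le_opNorm x
  rw [hf, one_mul] at h1
  rw [hx, mul_one] at h2
  exact h1.trans h2

theorem numericalRadius_le_opNorm (L : X →L[𝕜] X) : numericalRadius L ≤ ‖L‖ := by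
  refine Real.sSup_le ?_ (norm_nonneg _)
  rintro r ⟨x, f, hx, hf, -, rfl⟩
  exact norm_apply_apply_le_opNorm L hx hf

theorem norm_apply_apply_le_numericalRadius (L : X →L[𝕜] X) {x : X} {f : X →L[𝕜] 𝕜}
    (hx : ‖x‖ = 1) (hf : ‖f‖ = 1) (hfx : f x = 1) : ‖f (L x)‖ ≤ numericalRadius L := by
  refine le_csSup ⟨‖L‖, ?_⟩ ⟨x, f, hx, hf, hfx, rfl⟩
  rintro r ⟨x, f, hx, hf, -, rfl⟩
  exact norm_apply_apply_le_opNorm L hx hf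

end NumericalRadius

theorem ContinuousMap.norm_apply_le_numericalRadius {α : Type*} [TopologicalSpace α]
    [CompactSpace α] (L : C(α, ℝ) →L[ℝ] C(α, ℝ)) {f : C(α, ℝ)} (hf : ∀ y, |f y| ≤ 1) {a : α}
    (ha : f a = 1) : ‖L f a‖ ≤ numericalRadius L := by
  have hle : ‖f‖ ≤ 1 := (ContinuousMap.norm_le _ zero_le_one).2 hf
  have hge := f.norm_coe_le_norm a
  rw [ha, norm_one] at hge
  have hf1 : ‖f‖ = 1 := le_antisymm hle hge
  have hev : ‖ContinuousMap.evalCLM ℝ (M := ℝ) a‖ = 1 := by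
    refine le_antisymm (ContinuousLinearMap.opNorm_le_bound _ zero_le_one fun g => ?_) ?_
    · rw [one_mul]
      exact g.norm_coe_le_norm a
    · have h := (ContinuousMap.evalCLM ℝ (M := ℝ) a).le_opNorm f
      rw [hf1, mul_one] at h
      refine le_trans ?_ h
      change 1 ≤ ‖f a‖
      rw [ha, norm_one]
  exact norm_apply_apply_le_numericalRadius L (f := ContinuousMap.evalCLM ℝ a) hf1 hev ha

theorem IsFourierProjection.le_numericalRadius {n : ℕ} {F : C(Circ2pi, ℝ) →L[ℝ] C(Circ2pi, ℝ)}
    (hF : IsFourierProjection n F) :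
    2 / π * (∫ x in (0 : ℝ)..π, |dirichletKer n x|) ≤ numericalRadius F := by
  have hD := continuous_dirichletKer n
  have key : ∀ ε : ℝ, 0 < ε → ε ≤ 1 / 2 →
      2 / π * (∫ x in (0 : ℝ)..π, |dirichletKer n x|) - 2 * ε ≤ numericalRadius F := by
    intro ε hε hε'
    let f : C(Circ2pi, ℝ) :=
      ⟨fun θ => max (-1) (min 1 (dirichletKerC n θ / ε)), by fun_prop⟩
    have hfs : ∀ s : ℝ, f (s : Circ2pi) = max (-1) (min 1 (dirichletKer n s / ε)) := fun s => by
      rw [← dirichletKerC_apply]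
      rfl
    have hf1 : ∀ θ, |f θ| ≤ 1 := fun θ =>
      abs_le.2 ⟨le_max_left _ _, max_le (by norm_num) (min_le_left _ _)⟩
    have hf0 : f ((0 : ℝ) : Circ2pi) = 1 := by
      have h : 1 ≤ dirichletKer n 0 / ε := by
        rw [dirichletKer_zero, le_div_iff₀ hε]
        have : (0 : ℝ) ≤ n := by positivity
        linarith
      rw [hfs, min_eq_left h]
      norm_num
    refine le_trans ?_ (ContinuousMap.norm_apply_le_numericalRadius F hf1 hf0)
    refine le_trans ?_ (le_abs_self _)
    rw [hF.apply_eq_integral]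
    simp only [sub_zero]
    have hfc : Continuous fun s : ℝ => f (s : Circ2pi) :=
      f.continuous.comp (AddCircle.continuous_mk' _)
    have hpt : ∀ s : ℝ, |dirichletKer n s| - ε ≤ f (s : Circ2pi) * dirichletKer n s := by
      intro s
      rw [hfs]
      generalize dirichletKer n s = d
      rcases le_total ε d with h1 | h1
      · rw [min_eq_left ((one_le_div hε).2 h1), max_eq_right (by norm_num),
          abs_of_nonneg (hε.le.trans h1)]
        linarith
      · rw [min_eq_right ((div_le_one hε).2 h1)]
        rcases le_total d (-ε) with h2 | h2
        · rw [max_eq_left (by rw [div_le_iff₀ hε]; linarith), abs_of_nonpos (by linarith)]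
          linarith
        · rw [max_eq_right (by rw [le_div_iff₀ hε]; linarith)]
          have h3 : |d| ≤ ε := abs_le.2 ⟨h2, h1⟩
          have h4 : 0 ≤ d / ε * d := by
            rw [div_mul_eq_mul_div]
            exact div_nonneg (mul_self_nonneg d) hε.le
          linarith
    have hint := integral_mono_on (μ := volume) two_pi_pos.le
      (Continuous.intervalIntegrable (by fun_prop) _ _)
      (Continuous.intervalIntegrable (by fun_prop) _ _) fun s _ => hpt s
    rw [intervalIntegral.integral_sub (Continuous.intervalIntegrable (by fun_prop) _ _)
      intervalIntegrable_const, integral_abs_dirichletKer, intervalIntegral.integral_const,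
      smul_eq_mul, sub_zero] at hint
    calc 2 / π * (∫ x in (0 : ℝ)..π, |dirichletKer n x|) - 2 * ε
        = 1 / π * (2 * (∫ x in (0 : ℝ)..π, |dirichletKer n x|) - 2 * π * ε) := by field_simp
      _ ≤ _ := by gcongr
  refine le_of_forall_pos_le_add fun δ hδ => ?_
  have h := key (min (δ / 2) (1 / 2)) (by positivity) (min_le_right _ _)
  linarith [min_le_left (δ / 2) (1 / 2)]

/-- For `n ≥ 1`, the Fourier projection `F_n` on `C(2π)` satisfies
`(4/π²) ln n ≤ ‖F_n‖ ≤ ln n + 3`, and the same bounds hold for its numerical radius: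
`(4/π²) ln n ≤ ‖F_n‖_w ≤ ln n + 3`. -/
theorem fourierProjection_norm_numericalRadius_bounds (n : ℕ) (hn : 1 ≤ n)
    (F : C(Circ2pi, ℝ) →L[ℝ] C(Circ2pi, ℝ)) (hF : IsFourierProjection n F) :
    (4 / π ^ 2 * Real.log n ≤ ‖F‖ ∧ ‖F‖ ≤ Real.log n + 3) ∧
    (4 / π ^ 2 * Real.log n ≤ numericalRadius F ∧ numericalRadius F ≤ Real.log n + 3) := by
  have hlow : 4 / π ^ 2 * Real.log n ≤ numericalRadius F := by
    refine le_trans ?_ hF.le_numericalRadius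
    calc 4 / π ^ 2 * Real.log n = 2 / π * (2 / π * Real.log n) := by ring
      _ ≤ _ := by
        gcongr
        exact two_div_pi_mul_log_le_integral_abs_dirichletKer n hn
  have hup : ‖F‖ ≤ Real.log n + 3 := by
    refine hF.norm_le.trans ?_
    calc _ ≤ 2 / π * (π / 2 * (Real.log n + 3)) := by
          gcongr
          exact integral_abs_dirichletKer_le n hn
      _ = Real.log n + 3 := by field_simp
  have hle := numericalRadius_le_opNorm F
  exact ⟨⟨hlow.trans hle, hup⟩, hlow, hle.trans hup⟩
end
end

section
/- Let n < m be positive integers and let k_1 < k_2 < ... < k_m be positive integers. Let X = span{sin(k_i t), cos(k_i t) : i = 1, ..., m} and V = span{sin(k_i t), cos(k_i t) : i = 1, ..., n}, as spaces of 2π-periodic real functions, and let ‖·‖_X be any norm on X for which each translation T_g, (T_g f)(t) = f(t + g) (g ∈ ℝ), is a linear isometry of X. Then the linear projection Q : X → V determined by Q(sin(k_i ·)) = sin(k_i ·) and Q(cos(k_i ·)) = cos(k_i ·) for i ≤ n and Q(sin(k_i ·)) = Q(cos(k_i ·)) = 0 for i > n is the unique projection of X onto V commuting with all translations T_g, and Q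 is minimal: ‖Q‖ ≤ ‖P‖ for every linear projection P of X onto V, where operator norms are taken with respect to ‖·‖_X. -/
noncomputable section

/-- Translation of a real function: `(T_g f)(t) = f (t + g)`. -/
def transFun (g : ℝ) (f : ℝ → ℝ) : ℝ → ℝ := fun t => f (t + g)

/-- `span { sin (k i ⬝ t), cos (k i ⬝ t) : i ∈ s }` inside the space of real functions. -/
def trigSpan {m : ℕ} (k : Fin m → ℕ) (s : Set (Fin m)) : Submodule ℝ (ℝ → ℝ) :=
  Submodule.span ℝ
    (((fun i : Fin m => fun t : ℝ => Real.sin (k i * t)) '' s) ∪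
     ((fun i : Fin m => fun t : ℝ => Real.cos (k i * t)) '' s))

/-- The operator "norm" of a linear map `T` with respect to a norm-function `N`:
`sup { N (T f) : N f ≤ 1 }`. -/
def opNormOf {M : Type*} [AddCommGroup M] [Module ℝ M] (N : M → ℝ) (T : M →ₗ[ℝ] M) : ℝ :=
  sSup {r : ℝ | ∃ f : M, N f ≤ 1 ∧ r = N (T f)}

open Real

theorem opNormOf_bddAbove {M : Type*} [AddCommGroup M] [Module ℝ M] [FiniteDimensional ℝ M]
    (N : M → ℝ) (hzero : ∀ f, N f = 0 ↔ f = 0) (hsmul : ∀ (a : ℝ) f, N (a • f) = |a| * N f)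
    (hadd : ∀ f g, N (f + g) ≤ N f + N g) (T : M →ₗ[ℝ] M) :
    BddAbove {r : ℝ | ∃ f : M, N f ≤ 1 ∧ r = N (T f)} := by
  have hnonneg : ∀ f, 0 ≤ N f := fun f => by
    have h := hadd f ((-1 : ℝ) • f)
    rw [hsmul, neg_one_smul, add_neg_cancel, (hzero 0).2 rfl, abs_neg, abs_one] at h
    linarith
  let : Norm M := ⟨N⟩
  have core : NormedSpace.Core ℝ M :=
    { norm_nonneg := hnonneg
      norm_smul := hsmul
      norm_triangle := hadd
      norm_eq_zero_iff := hzero }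
  let : NormedAddCommGroup M := NormedAddCommGroup.ofCore core
  let : NormedSpace ℝ M := NormedSpace.ofCore core
  refine ⟨‖LinearMap.toContinuousLinearMap T‖, ?_⟩
  rintro r ⟨f, hf, rfl⟩
  exact (LinearMap.toContinuousLinearMap T).unit_le_opNorm f hf

/-- Translation as a linear endomorphism of the space of real functions. -/
def transLin (g : ℝ) : Module.End ℝ (ℝ → ℝ) where
  toFun := transFun g
  map_add' _ _ := rfl
  map_smul' _ _ := rfl

section Span

variable {m : ℕ} {k : Fin m → ℕ} {s : Set (Fin m)}

theorem sin_mem_trigSpan {i : Fin m} (hi : i ∈ s) :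
    (fun t : ℝ => sin (k i * t)) ∈ trigSpan k s :=
  Submodule.subset_span (Or.inl ⟨i, hi, rfl⟩)

theorem cos_mem_trigSpan {i : Fin m} (hi : i ∈ s) :
    (fun t : ℝ => cos (k i * t)) ∈ trigSpan k s :=
  Submodule.subset_span (Or.inr ⟨i, hi, rfl⟩)

theorem trigSpan_le {W : Submodule ℝ (ℝ → ℝ)}
    (hsin : ∀ i ∈ s, (fun t : ℝ => sin (k i * t)) ∈ W)
    (hcos : ∀ i ∈ s, (fun t : ℝ => cos (k i * t)) ∈ W) : trigSpan k s ≤ W := by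
  refine Submodule.span_le.2 ?_
  rintro _ (⟨i, hi, rfl⟩ | ⟨i, hi, rfl⟩)
  exacts [hsin i hi, hcos i hi]

instance : FiniteDimensional ℝ (trigSpan k s) :=
  FiniteDimensional.span_of_finite ℝ ((s.toFinite.image _).union (s.toFinite.image _))

theorem transFun_two_pi {f : ℝ → ℝ} (hf : f ∈ trigSpan k s) : transFun (2 * π) f = f := by
  have h : trigSpan k s ≤ LinearMap.eqLocus (transLin (2 * π)) LinearMap.id := by
    refine trigSpan_le (fun i _ => funext fun t => ?_) (fun i _ => funext fun t => ?_)
    · change sin (k i * (t + 2 * π)) = sin (k i * t)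
      rw [mul_add]
      exact sin_add_nat_mul_two_pi _ _
    · change cos (k i * (t + 2 * π)) = cos (k i * t)
      rw [mul_add]
      exact cos_add_nat_mul_two_pi _ _
  exact h hf

/-- Linear maps on `X` that agree on the sines and cosines with index in `s` agree on the span of
these. -/
theorem eq_of_mem_trigSpan {X : Submodule ℝ (ℝ → ℝ)} (hX : trigSpan k s ≤ X)
    {W : Type*} [AddCommGroup W] [Module ℝ W] {A B : X →ₗ[ℝ] W}
    (hsin : ∀ i ∈ s, ∀ h : (fun t : ℝ => sin (k i * t)) ∈ X, A ⟨_, h⟩ = B ⟨_, h⟩)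
    (hcos : ∀ i ∈ s, ∀ h : (fun t : ℝ => cos (k i * t)) ∈ X, A ⟨_, h⟩ = B ⟨_, h⟩)
    {v : X} (hv : (v : ℝ → ℝ) ∈ trigSpan k s) : A v = B v := by
  have h : trigSpan k s ≤ (LinearMap.eqLocus A B).map X.subtype :=
    trigSpan_le
      (fun i hi => ⟨⟨_, hX (sin_mem_trigSpan hi)⟩, hsin i hi _, rfl⟩)
      (fun i hi => ⟨⟨_, hX (cos_mem_trigSpan hi)⟩, hcos i hi _, rfl⟩)
  obtain ⟨w, hw, hwv⟩ := h hv
  obtain rfl : w = v := Subtype.ext hwv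
  exact hw

theorem transLin_add_neg_sin (c h : ℝ) :
    (transLin h + transLin (-h)) (fun t => sin (c * t)) =
      (2 * cos (c * h)) • fun t => sin (c * t) := by
  funext t
  change sin (c * (t + h)) + sin (c * (t + -h)) = 2 * cos (c * h) * sin (c * t)
  rw [mul_add, mul_add, mul_neg, sin_add, sin_add, cos_neg, sin_neg]
  ring

theorem transLin_add_neg_cos (c h : ℝ) :
    (transLin h + transLin (-h)) (fun t => cos (c * t)) =
      (2 * cos (c * h)) • fun t => cos (c * t) := by
  funext t
  change cos (c * (t + h)) + cos (c * (t + -h)) = 2 * cos (c * h) * cos (c * t)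
  rw [mul_add, mul_add, mul_neg, cos_add, cos_add, cos_neg, sin_neg]
  ring

/-- An eigenvector of `T_h + T_{-h}` in `trigSpan k s` with an eigenvalue that does not occur
there vanishes. -/
theorem eq_zero_of_mem_trigSpan {h μ : ℝ} (hμ : ∀ i ∈ s, 2 * cos (k i * h) ≠ μ) {u : ℝ → ℝ}
    (hu : u ∈ trigSpan k s) (huμ : (transLin h + transLin (-h)) u = μ • u) : u = 0 := by
  have hle : trigSpan k s ≤ ⨆ ν, ⨆ _ : ν ≠ μ, (transLin h + transLin (-h)).eigenspace ν :=
    trigSpan_le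
      (fun i hi => Submodule.mem_iSup_of_mem _ (Submodule.mem_iSup_of_mem (hμ i hi)
        (Module.End.mem_eigenspace_iff.2 (transLin_add_neg_sin _ h))))
      (fun i hi => Submodule.mem_iSup_of_mem _ (Submodule.mem_iSup_of_mem (hμ i hi)
        (Module.End.mem_eigenspace_iff.2 (transLin_add_neg_cos _ h))))
  exact Submodule.disjoint_def.1 ((transLin h + transLin (-h)).eigenspaces_iSupIndep μ) u
    (Module.End.mem_eigenspace_iff.2 huμ) (hle hu)

end Span

section Translation

variable {X : Submodule ℝ (ℝ → ℝ)} (hXinv : ∀ (g : ℝ) (f : ℝ → ℝ), f ∈ X → transFun g f ∈ X)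

/-- Translation as a linear endomorphism of a translation-invariant space. -/
def transEnd (g : ℝ) : X →ₗ[ℝ] X := (transLin g).restrict (hXinv g)

theorem transEnd_transEnd (a b : ℝ) (f : X) :
    transEnd hXinv a (transEnd hXinv b f) = transEnd hXinv (a + b) f :=
  Subtype.ext <| funext fun t => congrArg (f : ℝ → ℝ) (by ring)

theorem transEnd_zero (f : X) : transEnd hXinv 0 f = f :=
  Subtype.ext <| funext fun t => congrArg (f : ℝ → ℝ) (add_zero t)

/-- The average of the conjugates of `P` by the translations by `0, h, …, (M - 1) h`. -/
def transAverage (h : ℝ) (M : ℕ) (P : X →ₗ[ℝ] X) : X →ₗ[ℝ] X :=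
  (M : ℝ)⁻¹ • ∑ j ∈ Finset.range M,
    transEnd hXinv (-(j * h)) ∘ₗ P ∘ₗ transEnd hXinv (j * h)

theorem transAverage_apply (h : ℝ) (M : ℕ) (P : X →ₗ[ℝ] X) (f : X) :
    transAverage hXinv h M P f = (M : ℝ)⁻¹ • ∑ j ∈ Finset.range M,
      transEnd hXinv (-(j * h)) (P (transEnd hXinv (j * h) f)) := by
  simp [transAverage]

theorem transAverage_mem {V : Submodule ℝ (ℝ → ℝ)}
    (hVinv : ∀ (g : ℝ) (f : ℝ → ℝ), f ∈ V → transFun g f ∈ V) (h : ℝ) (M : ℕ) {P : X →ₗ[ℝ] X}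
    (hPV : ∀ f : X, (P f : ℝ → ℝ) ∈ V) (f : X) :
    (transAverage hXinv h M P f : ℝ → ℝ) ∈ V := by
  rw [transAverage_apply, Submodule.coe_smul, Submodule.coe_sum]
  exact V.smul_mem _ (V.sum_mem fun j _ => hVinv _ _ (hPV _))

theorem transAverage_eq_self {V : Submodule ℝ (ℝ → ℝ)}
    (hVinv : ∀ (g : ℝ) (f : ℝ → ℝ), f ∈ V → transFun g f ∈ V) (h : ℝ) {M : ℕ} (hM : M ≠ 0)
    {P : X →ₗ[ℝ] X} (hP : ∀ v : X, (v : ℝ → ℝ) ∈ V → P v = v) {v : X} (hv : (v : ℝ → ℝ) ∈ V) :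
    transAverage hXinv h M P v = v := by
  have hj : ∀ j ∈ Finset.range M,
      transEnd hXinv (-(j * h)) (P (transEnd hXinv (j * h) v)) = v := fun j _ => by
    rw [hP _ (hVinv _ _ hv), transEnd_transEnd, neg_add_cancel, transEnd_zero]
  rw [transAverage_apply, Finset.sum_congr rfl hj, Finset.sum_const, Finset.card_range,
    ← Nat.cast_smul_eq_nsmul ℝ, inv_smul_smul₀ (Nat.cast_ne_zero.2 hM)]

theorem transAverage_transEnd {h : ℝ} {M : ℕ} (hM : ∀ f : X, transEnd hXinv (M * h) f = f)
    (P : X →ₗ[ℝ] X) (f : X) :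
    transAverage hXinv h M P (transEnd hXinv h f) =
      transEnd hXinv h (transAverage hXinv h M P f) := by
  have hM' : ∀ f : X, transEnd hXinv (-(M * h)) f = f := fun f => by
    conv_lhs => rw [← hM f, transEnd_transEnd, neg_add_cancel, transEnd_zero]
  set F : ℕ → X := fun j => transEnd hXinv (-(j * h)) (P (transEnd hXinv (j * h) f)) with hF
  have hFM : F M = F 0 := by
    simp only [hF, hM, hM', Nat.cast_zero, zero_mul, neg_zero, transEnd_zero]
  have hstep : ∀ j : ℕ, transEnd hXinv (-(j * h)) (P (transEnd hXinv (j * h)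
      (transEnd hXinv h f))) = transEnd hXinv h (F (j + 1)) := fun j => by
    simp only [hF, transEnd_transEnd]
    push_cast
    congr 3 <;> ring_nf
  have hsum : ∑ j ∈ Finset.range M, F (j + 1) = ∑ j ∈ Finset.range M, F j :=
    add_right_cancel (b := F 0) <| by
      rw [← Finset.sum_range_succ', Finset.sum_range_succ, hFM]
  rw [transAverage_apply, transAverage_apply, Finset.sum_congr rfl fun j _ => hstep j, ← map_sum,
    hsum, map_smul]

theorem apply_transAverage_le {N : X → ℝ} (hsmul : ∀ (a : ℝ) (f : X), N (a • f) = |a| * N f)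
    (hadd : ∀ f g : X, N (f + g) ≤ N f + N g)
    (hiso : ∀ (g : ℝ) (f : X), N (transEnd hXinv g f) = N f) (h : ℝ) {M : ℕ} (hM : M ≠ 0)
    {P : X →ₗ[ℝ] X} {C : ℝ} (hC : ∀ f, N f ≤ 1 → N (P f) ≤ C) {f : X} (hf : N f ≤ 1) :
    N (transAverage hXinv h M P f) ≤ C := by
  have hzero : N 0 = 0 := by simpa using hsmul 0 0
  have hM0 : (0 : ℝ) < M := by positivity
  rw [transAverage_apply, hsmul, abs_of_pos (inv_pos.2 hM0), inv_mul_le_iff₀ hM0]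
  calc N (∑ j ∈ Finset.range M, transEnd hXinv (-(j * h)) (P (transEnd hXinv (j * h) f)))
      ≤ ∑ j ∈ Finset.range M, N (transEnd hXinv (-(j * h)) (P (transEnd hXinv (j * h) f))) :=
        Finset.le_sum_of_subadditive N hzero.le hadd _ _
    _ ≤ ∑ _j ∈ Finset.range M, C := Finset.sum_le_sum fun j _ => by
        rw [hiso]
        exact hC _ ((hiso _ _).trans_le hf)
    _ = M * C := by simp

/-- A projection onto `trigSpan k s` commuting with `T_h` kills every eigenvector of
`T_h + T_{-h}` whose eigenvalue does not occur in `trigSpan k s`. -/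
theorem apply_eq_zero_of_commute {m : ℕ} {k : Fin m → ℕ} {s : Set (Fin m)} {h μ : ℝ}
    {Q : X →ₗ[ℝ] X} (hQV : ∀ f : X, (Q f : ℝ → ℝ) ∈ trigSpan k s)
    (hQ : ∀ f, Q (transEnd hXinv h f) = transEnd hXinv h (Q f))
    (hμ : ∀ i ∈ s, 2 * cos (k i * h) ≠ μ) {f : X}
    (hf : (transLin h + transLin (-h)) (f : ℝ → ℝ) = μ • (f : ℝ → ℝ)) : Q f = 0 := by
  have hQ' : Q (transEnd hXinv (-h) f) = transEnd hXinv (-h) (Q f) := by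
    conv_rhs => rw [← transEnd_zero hXinv f, ← add_neg_cancel h, ← transEnd_transEnd, hQ,
      transEnd_transEnd, neg_add_cancel, transEnd_zero]
  have hf' : transEnd hXinv h f + transEnd hXinv (-h) f = μ • f := Subtype.ext hf
  have hQf := congrArg Q hf'
  rw [map_add, hQ, hQ', map_smul] at hQf
  exact Subtype.ext (eq_zero_of_mem_trigSpan hμ (hQV f) (congrArg Subtype.val hQf))

end Translation

theorem exists_injective_cos_mul {m : ℕ} {k : Fin m → ℕ} (hk : Function.Injective k) :
    ∃ M : ℕ, M ≠ 0 ∧ Function.Injective fun i => 2 * cos (k i * (2 * π / M)) := by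
  refine ⟨2 * ∑ i, k i + 1, by omega, fun i j hij => ?_⟩
  set M := 2 * ∑ i, k i + 1 with hM
  have hM0 : (0 : ℝ) < M := by positivity
  have hmem : ∀ i, (k i : ℝ) * (2 * π / M) ∈ Set.Icc 0 π := fun i => by
    refine ⟨by positivity, ?_⟩
    have hle : 2 * k i ≤ M := by
      have := Finset.single_le_sum (fun j _ => Nat.zero_le (k j)) (Finset.mem_univ i)
      omega
    have hle' : 2 * (k i : ℝ) ≤ M := by exact_mod_cast hle
    rw [← mul_div_assoc, div_le_iff₀ hM0]
    nlinarith [pi_pos]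
  have h := injOn_cos (hmem i) (hmem j) (mul_left_cancel₀ two_ne_zero hij)
  have hpos : 2 * π / (M : ℝ) ≠ 0 := by positivity
  exact hk (Nat.cast_injective (R := ℝ) (mul_right_cancel₀ hpos h))

/-- Let `n < m` and `k₁ < ⋯ < k_m` be positive integers, let
`X = span(sin (k_i t), cos (k_i t) : i ≤ m)` and `V = span(sin (k_i t), cos (k_i t) : i ≤ n)`,
and let `N` be any norm on `X` for which every translation `T_g` is a linear isometry of `X`.
Then the projection `Q` with `Q (sin (k_i ⬝)) = sin (k_i ⬝)`, `Q (cos (k_i ⬝)) = cos (k_i ⬝)` for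
`i ≤ n` and `Q (sin (k_i ⬝)) = Q (cos (k_i ⬝)) = 0` for `i > n` is the unique projection of `X`
onto `V` commuting with all translations, and `Q` is a minimal projection with respect to the
operator norm induced by `N`. -/
theorem trig_unique_commuting_projection_minimal
    (m n : ℕ) (hn : 0 < n) (hnm : n < m)
    (k : Fin m → ℕ) (hkpos : ∀ i, 0 < k i) (hkmono : StrictMono k)
    -- `X` and `V`:
    (X : Submodule ℝ (ℝ → ℝ)) (hX : X = trigSpan k Set.univ)
    (V : Submodule ℝ (ℝ → ℝ)) (hV : V = trigSpan k {i | (i : ℕ) < n})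
    -- translations map `X` into `X` and `V` into `V`:
    (hXinv : ∀ (g : ℝ) (f : ℝ → ℝ), f ∈ X → transFun g f ∈ X)
    (hVinv : ∀ (g : ℝ) (f : ℝ → ℝ), f ∈ V → transFun g f ∈ V)
    -- `N` is a norm on `X`:
    (N : ↥X → ℝ)
    (hNzero : ∀ f : ↥X, N f = 0 ↔ f = 0)
    (hNsmul : ∀ (a : ℝ) (f : ↥X), N (a • f) = |a| * N f)
    (hNadd : ∀ f g : ↥X, N (f + g) ≤ N f + N g)
    -- every translation is an isometry of `(X, N)`:
    (hNiso : ∀ (g : ℝ) (f : ↥X) (h : transFun g (f : ℝ → ℝ) ∈ X),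
      N ⟨transFun g (f : ℝ → ℝ), h⟩ = N f)
    -- the projection `Q` of `X` onto `V`:
    (Q : ↥X →ₗ[ℝ] ↥X)
    (hQV : ∀ f : ↥X, (Q f : ℝ → ℝ) ∈ V)
    (hQsin₁ : ∀ (i : Fin m), (i : ℕ) < n →
      ∀ h : (fun t : ℝ => Real.sin (k i * t)) ∈ X, Q ⟨_, h⟩ = ⟨_, h⟩)
    (hQcos₁ : ∀ (i : Fin m), (i : ℕ) < n →
      ∀ h : (fun t : ℝ => Real.cos (k i * t)) ∈ X, Q ⟨_, h⟩ = ⟨_, h⟩)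
    (hQsin₂ : ∀ (i : Fin m), n ≤ (i : ℕ) →
      ∀ h : (fun t : ℝ => Real.sin (k i * t)) ∈ X, Q ⟨_, h⟩ = 0)
    (hQcos₂ : ∀ (i : Fin m), n ≤ (i : ℕ) →
      ∀ h : (fun t : ℝ => Real.cos (k i * t)) ∈ X, Q ⟨_, h⟩ = 0) :
    -- `Q` is a projection onto `V` commuting with all translations,
    (∀ v : ↥X, (v : ℝ → ℝ) ∈ V → Q v = v) ∧
    (∀ (g : ℝ) (f : ↥X) (h : transFun g (f : ℝ → ℝ) ∈ X),
      (Q ⟨transFun g (f : ℝ → ℝ), h⟩ : ℝ → ℝ) = transFun g (Q f : ℝ → ℝ)) ∧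
    -- it is the unique such projection,
    (∀ Q' : ↥X →ₗ[ℝ] ↥X, (∀ f : ↥X, (Q' f : ℝ → ℝ) ∈ V) →
      (∀ v : ↥X, (v : ℝ → ℝ) ∈ V → Q' v = v) →
      (∀ (g : ℝ) (f : ↥X) (h : transFun g (f : ℝ → ℝ) ∈ X),
        (Q' ⟨transFun g (f : ℝ → ℝ), h⟩ : ℝ → ℝ) = transFun g (Q' f : ℝ → ℝ)) →
      Q' = Q) ∧
    -- and `Q` is minimal among all projections of `X` onto `V`:
    (∀ P : ↥X →ₗ[ℝ] ↥X, (∀ f : ↥X, (P f : ℝ → ℝ) ∈ V) →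
      (∀ v : ↥X, (v : ℝ → ℝ) ∈ V → P v = v) →
      opNormOf N Q ≤ opNormOf N P) := by
  subst hX hV
  have hVX : trigSpan k {i | (i : ℕ) < n} ≤ trigSpan k Set.univ :=
    trigSpan_le (fun i _ => sin_mem_trigSpan (Set.mem_univ i))
      (fun i _ => cos_mem_trigSpan (Set.mem_univ i))
  have hQid : ∀ v : trigSpan k Set.univ, (v : ℝ → ℝ) ∈ trigSpan k {i | (i : ℕ) < n} → Q v = v :=
    fun v hv => eq_of_mem_trigSpan (B := LinearMap.id) hVX hQsin₁ hQcos₁ hv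
  obtain ⟨M, hM, hcos⟩ := exists_injective_cos_mul hkmono.injective
  have huniq : ∀ Q' : trigSpan k Set.univ →ₗ[ℝ] trigSpan k Set.univ,
      (∀ f, (Q' f : ℝ → ℝ) ∈ trigSpan k {i | (i : ℕ) < n}) →
      (∀ v : trigSpan k Set.univ, (v : ℝ → ℝ) ∈ trigSpan k {i | (i : ℕ) < n} → Q' v = v) →
      (∀ f, Q' (transEnd hXinv (2 * π / M) f) = transEnd hXinv (2 * π / M) (Q' f)) →
      Q' = Q := by
    intro Q' hV hid hcomm
    have hne : ∀ i : Fin m, n ≤ i → ∀ j ∈ {j : Fin m | (j : ℕ) < n},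
        2 * cos (k j * (2 * π / M)) ≠ 2 * cos (k i * (2 * π / M)) := by
      intro i hi j hj h
      have hj' : (j : ℕ) < n := hj
      rw [hcos h] at hj'
      omega
    refine LinearMap.ext fun f => eq_of_mem_trigSpan le_rfl ?_ ?_ f.2
    · intro i _ h
      rcases lt_or_ge (i : ℕ) n with hi | hi
      · rw [hQsin₁ i hi h, hid _ (sin_mem_trigSpan hi)]
      · rw [hQsin₂ i hi h]
        exact apply_eq_zero_of_commute hXinv hV hcomm (hne i hi) (transLin_add_neg_sin _ _)
    · intro i _ h
      rcases lt_or_ge (i : ℕ) n with hi | hi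
      · rw [hQcos₁ i hi h, hid _ (cos_mem_trigSpan hi)]
      · rw [hQcos₂ i hi h]
        exact apply_eq_zero_of_commute hXinv hV hcomm (hne i hi) (transLin_add_neg_cos _ _)
  have hS : ∀ i, (fun t : ℝ => sin (k i * t)) ∈ trigSpan k Set.univ :=
    fun i => sin_mem_trigSpan (Set.mem_univ i)
  have hC : ∀ i, (fun t : ℝ => cos (k i * t)) ∈ trigSpan k Set.univ :=
    fun i => cos_mem_trigSpan (Set.mem_univ i)
  have hTS : ∀ g i, transEnd hXinv g ⟨_, hS i⟩ =
      cos (k i * g) • ⟨_, hS i⟩ + sin (k i * g) • ⟨_, hC i⟩ := fun g i =>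
    Subtype.ext <| funext fun t => by
      change sin (k i * (t + g)) = cos (k i * g) * sin (k i * t) + sin (k i * g) * cos (k i * t)
      rw [mul_add, sin_add]
      ring
  have hTC : ∀ g i, transEnd hXinv g ⟨_, hC i⟩ =
      cos (k i * g) • ⟨_, hC i⟩ - sin (k i * g) • ⟨_, hS i⟩ := fun g i =>
    Subtype.ext <| funext fun t => by
      change cos (k i * (t + g)) = cos (k i * g) * cos (k i * t) - sin (k i * g) * sin (k i * t)
      rw [mul_add, cos_add]
      ring
  refine ⟨hQid, fun g f h => ?_, fun Q' hV hid hcomm => huniq Q' hV hid fun f =>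
    Subtype.ext (hcomm _ f _), fun P hPV hPid => ?_⟩
  · have hcomm : (Q ∘ₗ transEnd hXinv g) f = (transEnd hXinv g ∘ₗ Q) f := by
      refine eq_of_mem_trigSpan le_rfl (fun i _ h => ?_) (fun i _ h => ?_) f.2
      · rw [LinearMap.comp_apply, LinearMap.comp_apply, hTS, map_add, map_smul, map_smul]
        rcases lt_or_ge (i : ℕ) n with hi | hi
        · rw [hQsin₁ i hi, hQcos₁ i hi, hTS]
        · rw [hQsin₂ i hi, hQcos₂ i hi, smul_zero, smul_zero, map_zero, add_zero]
      · rw [LinearMap.comp_apply, LinearMap.comp_apply, hTC, map_sub, map_smul, map_smul]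
        rcases lt_or_ge (i : ℕ) n with hi | hi
        · rw [hQsin₁ i hi, hQcos₁ i hi, hTC]
        · rw [hQsin₂ i hi, hQcos₂ i hi, smul_zero, smul_zero, map_zero, sub_zero]
    exact congrArg Subtype.val hcomm
  · have hperiod : ∀ f, transEnd hXinv (M * (2 * π / M)) f = f := fun f => by
      rw [mul_div_cancel₀ _ (Nat.cast_ne_zero.2 hM)]
      exact Subtype.ext (transFun_two_pi f.2)
    rw [← huniq (transAverage hXinv (2 * π / M) M P) (transAverage_mem hXinv hVinv _ _ hPV)
      (fun v => transAverage_eq_self hXinv hVinv _ hM hPid) (transAverage_transEnd hXinv hperiod P)]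
    refine csSup_le ⟨_, 0, by simp [(hNzero 0).2 rfl], rfl⟩ ?_
    rintro r ⟨f, hf, rfl⟩
    exact apply_transAverage_le hXinv hNsmul hNadd (fun g f => hNiso g f _) _ hM
      (fun f hf => le_csSup (opNormOf_bddAbove N hNzero hNsmul hNadd P) ⟨f, hf, rfl⟩) hf
end
end
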